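/- arXiv:0812.2649 — 2 statements merged into one kernel-verified Lean document; each statement's English description precedes it below -/
import Mathlib

section
/- The real quadratic number field ℚ(√229) (e.g. realized as AdjoinRoot of the polynomial X² − 229 over ℚ) has class number 3. -/
open Polynomial

theorem irreducible_X_sq_sub_229 : Irreducible (X ^ 2 - C (229 : ℚ)) := by
  apply X_pow_sub_C_irreducible_of_prime Nat.prime_two
  intro b hb
  have h229 : Irrational (Real.sqrt 229) := Nat.Prime.irrational_sqrt (by norm_num)
  have hb' : ((b : ℝ)) ^ 2 = 229 := by exact_mod_cast congrArg (fun q : ℚ => (q : ℝ)) hb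
  have : Real.sqrt 229 = |(b : ℝ)| := by
    rw [← hb', Real.sqrt_sq_eq_abs]
  exact h229 ⟨|b|, by push_cast; rw [this]⟩

instance : Fact (Irreducible (X ^ 2 - C (229 : ℚ))) := ⟨irreducible_X_sq_sub_229⟩

open NumberField nonZeroDivisors

/-- A solution of `x² - 229 y² = ±12` could be made smaller by multiplying with the inverse of the
unit `(15 + √229) / 2`. -/
theorem sq_sub_229_mul_sq_ne (x y : ℤ) : (x ^ 2 - 229 * y ^ 2) ^ 2 ≠ 12 ^ 2 := by
  intro h
  induction hn : y.natAbs using Nat.strong_induction_on generalizing x y with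
  | _ n ih =>
  wlog hx : 0 ≤ x generalizing x
  · exact this (-x) (by simpa using h) (by omega)
  wlog hy : 0 ≤ y generalizing y
  · exact this (-y) (by simpa using hn) (by simpa using h) (by omega)
  rcases sq_eq_sq_iff_eq_or_eq_neg.mp h with h' | h'
  all_goals
    obtain rfl | hy0 := hy.eq_or_lt
    · have : x < 4 := by nlinarith
      interval_cases x <;> omega
    have h2 : (2 : ℤ) ∣ x - 15 * y := by
      rw [← even_iff_two_dvd]
      have : Even (x ^ 2 - 229 * y ^ 2) := h' ▸ by decide
      simp only [parity_simps] at this ⊢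
      have h229 : ¬ Even (229 : ℤ) := by decide
      have h15 : ¬ Even (15 : ℤ) := by decide
      simp_all
    obtain ⟨z, hz⟩ := h2
    have h1 : x < 17 * y := by nlinarith
    have h3 : 13 * y < x := by nlinarith
    refine ih z.natAbs (by omega) (-15 * z + 2 * y) z ?_ rfl
    obtain rfl : x = 15 * y + 2 * z := by linarith
    rw [← h]
    ring

theorem Ideal.dvd_of_intCast_mem {R : Type*} [CommRing R] {P : Ideal R} (hP : P ≠ ⊤) {p : ℕ}
    (hp : p.Prime) (hpP : (p : R) ∈ P) {n : ℤ} (hn : (n : R) ∈ P) : (p : ℤ) ∣ n := by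
  by_contra h
  obtain ⟨u, v, huv⟩ := (Nat.prime_iff_prime_int.mp hp).coprime_iff_not_dvd.mpr h
  refine hP (P.eq_top_iff_one.mpr ?_)
  have : (1 : R) = u * (p : R) + v * (n : R) := by
    exact_mod_cast congrArg (Int.cast (R := R)) huv.symm
  rw [this]
  exact P.add_mem (P.mul_mem_left _ hpP) (P.mul_mem_left _ hn)

/-- A subgroup of the class group containing the classes of all prime ideals of norm at most the
Minkowski bound is the whole class group. -/
theorem Subgroup.eq_top_of_mk0_mem {K : Type*} [Field K] [NumberField K]
    (H : Subgroup (ClassGroup (𝓞 K))) {N : ℕ}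
    (hN : (4 / Real.pi) ^ InfinitePlace.nrComplexPlaces K *
      ((Module.finrank ℚ K).factorial / (Module.finrank ℚ K) ^ Module.finrank ℚ K *
        √|discr K|) < N + 1)
    (h : ∀ P : (Ideal (𝓞 K))⁰, (P : Ideal (𝓞 K)).IsPrime → Ideal.absNorm (P : Ideal (𝓞 K)) ≤ N →
      ClassGroup.mk0 P ∈ H) : H = ⊤ := by
  refine (Subgroup.eq_top_iff' H).mpr fun C ↦ ?_
  obtain ⟨I, rfl, hI⟩ := exists_ideal_in_class_of_norm_le C
  have hIN : Ideal.absNorm (I : Ideal (𝓞 K)) ≤ N := by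
    exact_mod_cast Nat.lt_succ_iff.mp (by exact_mod_cast hI.trans_lt hN)
  clear hI
  obtain ⟨I, hI⟩ := I
  induction I using UniqueFactorizationMonoid.induction_on_prime with
  | h₁ => simp at hI
  | h₂ I hu =>
    obtain rfl := Ideal.isUnit_iff.mp hu
    rw [(ClassGroup.mk0_eq_one_iff hI).mpr top_isPrincipal]
    exact H.one_mem
  | h₃ J P hJ hP ih =>
    have hJ' := mem_nonZeroDivisors_of_ne_zero hJ
    have hP' := mem_nonZeroDivisors_of_ne_zero hP.ne_zero
    have hmul : ClassGroup.mk0 ⟨P * J, hI⟩ = ClassGroup.mk0 ⟨P, hP'⟩ * ClassGroup.mk0 ⟨J, hJ'⟩ :=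
      map_mul ClassGroup.mk0 (⟨P, hP'⟩ : (Ideal (𝓞 K))⁰) ⟨J, hJ'⟩
    have hJ0 := Ideal.absNorm_pos_of_nonZeroDivisors ⟨J, hJ'⟩
    have hP0 := Ideal.absNorm_pos_of_nonZeroDivisors ⟨P, hP'⟩
    simp only [map_mul] at hIN hJ0 hP0
    rw [hmul]
    exact H.mul_mem (h _ (Ideal.isPrime_of_prime hP) (by simp only; nlinarith))
      (ih hJ' (by simp only; nlinarith))

section QuadraticOrder

variable {R : Type*} [CommRing R] {ω : R}

theorem eq_span_pair_of_sub_mem (hspan : ∀ x : R, ∃ a b : ℤ, x = a + b * ω) {P : Ideal R}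
    (hP : P ≠ ⊤) {p : ℕ} (hp : p.Prime) (hpP : (p : R) ∈ P) {c : ℤ} (hc : ω - c ∈ P) :
    P = Ideal.span {(p : R), ω - c} := by
  refine le_antisymm (fun x hx ↦ ?_) (by simp [Ideal.span_le, Set.insert_subset_iff, hpP, hc])
  obtain ⟨a, b, rfl⟩ := hspan x
  have hmem : ((a + b * c : ℤ) : R) ∈ P := by
    convert P.sub_mem hx (P.mul_mem_left b hc) using 1
    push_cast
    ring
  obtain ⟨k, hk⟩ := Ideal.dvd_of_intCast_mem hP hp hpP hmem
  have hk' : (a : R) + b * c = p * k := by exact_mod_cast congrArg (Int.cast (R := R)) hk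
  exact Ideal.mem_span_pair.mpr ⟨k, b, by linear_combination -hk'⟩

theorem eq_span_singleton_of_anisotropic (hω : ω ^ 2 = ω + 57)
    (hspan : ∀ x : R, ∃ a b : ℤ, x = a + b * ω) {P : Ideal R}
    (hP : P ≠ ⊤) {p : ℕ} (hp : p.Prime) (hpP : (p : R) ∈ P)
    (h : ∀ a b : ZMod p, a ^ 2 + a * b - 57 * b ^ 2 = 0 → a = 0 ∧ b = 0) :
    P = Ideal.span {(p : R)} := by
  refine le_antisymm (fun x hx ↦ ?_) (by simpa [Ideal.span_le] using hpP)
  obtain ⟨a, b, rfl⟩ := hspan x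
  have hmem : ((a ^ 2 + a * b - 57 * b ^ 2 : ℤ) : R) ∈ P := by
    convert P.mul_mem_left (a + b - b * ω) hx using 1
    push_cast
    linear_combination b ^ 2 * hω
  have hdvd := Ideal.dvd_of_intCast_mem hP hp hpP hmem
  rw [← ZMod.intCast_zmod_eq_zero_iff_dvd] at hdvd
  push_cast at hdvd
  obtain ⟨ha, hb⟩ := h _ _ hdvd
  rw [ZMod.intCast_zmod_eq_zero_iff_dvd] at ha hb
  obtain ⟨k, rfl⟩ := ha
  obtain ⟨l, rfl⟩ := hb
  exact Ideal.mem_span_singleton.mpr ⟨k + l * ω, by push_cast; ring⟩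

theorem span_three_mul_span_three (hω : ω ^ 2 = ω + 57) :
    Ideal.span {3, ω} * Ideal.span {3, ω - 1} = Ideal.span {3} := by
  rw [Ideal.span_pair_mul_span_pair]
  apply le_antisymm
  · simp only [Ideal.span_le, Set.insert_subset_iff, Set.singleton_subset_iff, SetLike.mem_coe,
      Ideal.mem_span_singleton]
    exact ⟨⟨3, by ring⟩, ⟨ω - 1, by ring⟩, ⟨ω, by ring⟩, ⟨19, by linear_combination hω⟩⟩
  · rw [Ideal.span_singleton_le_iff_mem]
    simp only [Ideal.mem_span_insert, Ideal.mem_span_singleton]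
    exact ⟨0, _, ⟨-1, _, ⟨1, _, ⟨0, rfl⟩, rfl⟩, rfl⟩, by ring⟩

theorem span_three_mul_span_five (hω : ω ^ 2 = ω + 57) :
    Ideal.span {3, ω} * Ideal.span {5, ω + 1} = Ideal.span {ω + 6} := by
  rw [Ideal.span_pair_mul_span_pair]
  apply le_antisymm
  · simp only [Ideal.span_le, Set.insert_subset_iff, Set.singleton_subset_iff, SetLike.mem_coe,
      Ideal.mem_span_singleton]
    exact ⟨⟨ω - 7, by linear_combination -hω⟩, ⟨10 - ω, by linear_combination hω⟩,
      ⟨19 - 2 * ω, by linear_combination 2 * hω⟩, ⟨3 * ω - 19, by linear_combination -2 * hω⟩⟩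
  · rw [Ideal.span_singleton_le_iff_mem]
    simp only [Ideal.mem_span_insert, Ideal.mem_span_singleton]
    exact ⟨0, _, ⟨2, _, ⟨-1, _, ⟨0, rfl⟩, rfl⟩, rfl⟩, by ring⟩

theorem span_three_mul_span_five' (hω : ω ^ 2 = ω + 57) :
    Ideal.span {3, ω - 1} * Ideal.span {5, ω - 2} = Ideal.span {ω - 7} := by
  rw [Ideal.span_pair_mul_span_pair]
  apply le_antisymm
  · simp only [Ideal.span_le, Set.insert_subset_iff, Set.singleton_subset_iff, SetLike.mem_coe,
      Ideal.mem_span_singleton]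
    exact ⟨⟨ω + 6, by linear_combination -hω⟩, ⟨ω + 9, by linear_combination -hω⟩,
      ⟨2 * ω + 17, by linear_combination -2 * hω⟩, ⟨3 * ω + 16, by linear_combination -2 * hω⟩⟩
  · rw [Ideal.span_singleton_le_iff_mem]
    simp only [Ideal.mem_span_insert, Ideal.mem_span_singleton]
    exact ⟨-4, _, ⟨1, _, ⟨0, _, ⟨1, rfl⟩, rfl⟩, rfl⟩, by linear_combination -hω⟩

theorem span_three_sq (hω : ω ^ 2 = ω + 57) :
    Ideal.span {3, ω} ^ 2 = Ideal.span {9, ω + 3} := by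
  rw [sq, Ideal.span_pair_mul_span_pair]
  apply le_antisymm
  · simp only [Ideal.span_le, Set.insert_subset_iff, Set.singleton_subset_iff, SetLike.mem_coe,
      Ideal.mem_span_pair]
    exact ⟨⟨1, 0, by ring⟩, ⟨-1, 3, by ring⟩, ⟨-1, 3, by ring⟩, ⟨6, 1, by linear_combination -hω⟩⟩
  · simp only [Ideal.span_le, Set.insert_subset_iff, Set.singleton_subset_iff, SetLike.mem_coe,
      Ideal.mem_span_insert, Ideal.mem_span_singleton]
    exact ⟨⟨1, _, ⟨0, _, ⟨0, _, ⟨0, rfl⟩, rfl⟩, rfl⟩, by ring⟩,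
      ⟨-6, _, ⟨0, _, ⟨0, _, ⟨1, rfl⟩, rfl⟩, rfl⟩, by linear_combination -hω⟩⟩

theorem span_three_cubed (hω : ω ^ 2 = ω + 57) :
    Ideal.span {3, ω} ^ 3 = Ideal.span {ω - 6} := by
  rw [pow_succ, span_three_sq hω, Ideal.span_pair_mul_span_pair]
  apply le_antisymm
  · simp only [Ideal.span_le, Set.insert_subset_iff, Set.singleton_subset_iff, SetLike.mem_coe,
      Ideal.mem_span_singleton]
    exact ⟨⟨ω + 5, by linear_combination -hω⟩, ⟨2 * ω + 19, by linear_combination -2 * hω⟩,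
      ⟨ω + 8, by linear_combination -hω⟩, ⟨3 * ω + 19, by linear_combination -2 * hω⟩⟩
  · rw [Ideal.span_singleton_le_iff_mem]
    simp only [Ideal.mem_span_insert, Ideal.mem_span_singleton]
    exact ⟨-2, _, ⟨0, _, ⟨-1, _, ⟨1, rfl⟩, rfl⟩, rfl⟩, by linear_combination -hω⟩

/-- Multiplicativity of the norm form `a² + ab - 57b²` of `ℤ[ω]`. -/
theorem sq_add_mul_sub_dvd (hω : ω ^ 2 = ω + 57)
    (hindep : ∀ a b : ℤ, (a : R) + b * ω = 0 → a = 0 ∧ b = 0)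
    (hspan : ∀ x : R, ∃ a b : ℤ, x = a + b * ω) {a b c d : ℤ}
    (h : (a : R) + b * ω ∣ c + d * ω) :
    a ^ 2 + a * b - 57 * b ^ 2 ∣ c ^ 2 + c * d - 57 * d ^ 2 := by
  obtain ⟨k, hk⟩ := h
  obtain ⟨e, f, rfl⟩ := hspan k
  obtain ⟨h1, h2⟩ := hindep (a * e + 57 * b * f - c) (a * f + b * e + b * f - d) (by
    push_cast
    linear_combination -hk - b * f * hω)
  refine ⟨e ^ 2 + e * f - 57 * f ^ 2, ?_⟩
  obtain rfl := sub_eq_zero.mp h1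
  obtain rfl := sub_eq_zero.mp h2
  ring

theorem not_isPrincipal_span_three (hω : ω ^ 2 = ω + 57)
    (hindep : ∀ a b : ℤ, (a : R) + b * ω = 0 → a = 0 ∧ b = 0)
    (hspan : ∀ x : R, ∃ a b : ℤ, x = a + b * ω) :
    ¬ (Ideal.span {3, ω}).IsPrincipal := by
  rintro ⟨g, hg⟩
  rw [Ideal.submodule_span_eq] at hg
  obtain ⟨a, b, rfl⟩ := hspan g
  have h3 : (3 : R) ∈ Ideal.span {(a : R) + b * ω} := hg ▸ Ideal.subset_span (by simp)
  have hω' : ω ∈ Ideal.span {(a : R) + b * ω} := hg ▸ Ideal.subset_span (by simp)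
  rw [Ideal.mem_span_singleton] at h3 hω'
  have h9 : a ^ 2 + a * b - 57 * b ^ 2 ∣ 9 := by
    simpa using sq_add_mul_sub_dvd hω hindep hspan (c := 3) (d := 0) (by simpa using h3)
  have h57 : a ^ 2 + a * b - 57 * b ^ 2 ∣ 57 := by
    simpa using sq_add_mul_sub_dvd hω hindep hspan (c := 0) (d := 1) (by simpa using hω')
  have hdvd : a ^ 2 + a * b - 57 * b ^ 2 ∣ 3 := (Int.dvd_coe_gcd h9 h57 :)
  have hne (h : (a ^ 2 + a * b - 57 * b ^ 2) ^ 2 = 3 ^ 2) : False :=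
    sq_sub_229_mul_sq_ne (2 * a + b) b (by linear_combination 16 * h)
  have hone (h : a ^ 2 + a * b - 57 * b ^ 2 ∣ 1) : False := by
    have hunit : (a : R) + b * ω ∣ 1 := by
      have : (a : R) + b * ω ∣ ((a ^ 2 + a * b - 57 * b ^ 2 : ℤ) : R) :=
        ⟨a + b - b * ω, by push_cast; linear_combination b ^ 2 * hω⟩
      exact this.trans (by exact_mod_cast Int.cast_dvd_cast (α := R) _ _ h)
    have hmem : (1 : R) ∈ Ideal.span {3, ω} := hg ▸ Ideal.mem_span_singleton.mpr hunit
    obtain ⟨u, v, huv⟩ := Ideal.mem_span_pair.mp hmem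
    obtain ⟨c, d, hcd⟩ := hspan (u * (ω - 1) + 19 * v)
    have := (hindep (3 * c + 1) (3 * d - 1) (by
      push_cast
      linear_combination -3 * hcd + (ω - 1) * huv - v * hω)).1
    omega
  have hle := Int.le_of_dvd (by norm_num) hdvd
  have hge := Int.le_of_dvd (by norm_num) (neg_dvd.mpr hdvd)
  have : (a ^ 2 + a * b - 57 * b ^ 2) ^ 2 = 3 ^ 2 ∨ a ^ 2 + a * b - 57 * b ^ 2 ∣ 1 := by
    generalize a ^ 2 + a * b - 57 * b ^ 2 = n at *
    clear * - hdvd hle hge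
    have : -3 ≤ n := by omega
    interval_cases n <;> revert hdvd <;> decide
  exact this.elim hne hone

variable [IsDedekindDomain R]

theorem mk0_eq_one_of_eq_span_singleton {I : (Ideal R)⁰} {x : R}
    (h : (I : Ideal R) = Ideal.span {x}) : ClassGroup.mk0 I = 1 :=
  (ClassGroup.mk0_eq_one_iff I.2).mpr ⟨x, h⟩

theorem mk0_eq_inv_of_mul_eq_span_singleton {I J : (Ideal R)⁰} {x : R}
    (h : (I : Ideal R) * J = Ideal.span {x}) : ClassGroup.mk0 I = (ClassGroup.mk0 J)⁻¹ := by
  rw [eq_inv_iff_mul_eq_one, ← map_mul]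
  exact mk0_eq_one_of_eq_span_singleton h

/-- Every prime of residue characteristic at most `7` is a power of `(3, ω)` in the class group. -/
theorem mk0_mem_zpowers [CharZero R] (hω : ω ^ 2 = ω + 57)
    (hspan : ∀ x : R, ∃ a b : ℤ, x = a + b * ω) {I : (Ideal R)⁰}
    (hI : (I : Ideal R) = Ideal.span {3, ω}) {P : (Ideal R)⁰} (hP : (P : Ideal R).IsPrime)
    {p : ℕ} (hp : p.Prime) (hp7 : p ≤ 7) (hpP : (p : R) ∈ (P : Ideal R)) :
    ClassGroup.mk0 P ∈ Subgroup.zpowers (ClassGroup.mk0 I) := by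
  obtain ⟨J, hJ⟩ : ∃ J : (Ideal R)⁰, (J : Ideal R) = Ideal.span {3, ω - 1} :=
    ⟨⟨Ideal.span {3, ω - 1}, mem_nonZeroDivisors_of_ne_zero (by simp)⟩, rfl⟩
  have hImem : ClassGroup.mk0 I ∈ Subgroup.zpowers (ClassGroup.mk0 I) := Subgroup.mem_zpowers _
  have hJmem : ClassGroup.mk0 J ∈ Subgroup.zpowers (ClassGroup.mk0 I) := by
    rw [← inv_mem_iff, ← mk0_eq_inv_of_mul_eq_span_singleton (I := I) (J := J) (x := 3)
      (by rw [hI, hJ, span_three_mul_span_three hω])]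
    exact hImem
  have hanis (h : ∀ a b : ZMod p, a ^ 2 + a * b - 57 * b ^ 2 = 0 → a = 0 ∧ b = 0) :
      ClassGroup.mk0 P ∈ Subgroup.zpowers (ClassGroup.mk0 I) := by
    rw [mk0_eq_one_of_eq_span_singleton
      (eq_span_singleton_of_anisotropic hω hspan hP.ne_top hp hpP h)]
    exact one_mem _
  have hpair (c : ℤ) (h : ω - c ∈ (P : Ideal R)) :=
    eq_span_pair_of_sub_mem hspan hP.ne_top hp hpP h
  obtain rfl | rfl | rfl | rfl : p = 2 ∨ p = 3 ∨ p = 5 ∨ p = 7 := by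
    clear * - hp hp7
    revert hp
    decide +revert
  · exact hanis (by decide)
  · have : ω * (ω - 1) ∈ (P : Ideal R) := by
      convert (P : Ideal R).mul_mem_left 19 hpP using 1
      push_cast
      linear_combination hω
    rcases hP.mem_or_mem this with h | h
    · obtain rfl : P = I := Subtype.ext (by simpa [hI] using hpair 0 (by simpa using h))
      exact hImem
    · obtain rfl : P = J := Subtype.ext (by simpa [hJ] using hpair 1 (by simpa using h))
      exact hJmem
  · have : (ω + 1) * (ω - 2) ∈ (P : Ideal R) := by
      convert (P : Ideal R).mul_mem_left 11 hpP using 1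
      push_cast
      linear_combination hω
    rcases hP.mem_or_mem this with h | h
    · have hP5 : (P : Ideal R) = Ideal.span {5, ω + 1} := by
        simpa using hpair (-1) (by simpa using h)
      rw [← inv_mem_iff, ← mk0_eq_inv_of_mul_eq_span_singleton (I := I) (x := ω + 6)
        (by rw [hI, hP5, span_three_mul_span_five hω])]
      exact hImem
    · have hP5 : (P : Ideal R) = Ideal.span {5, ω - 2} := by
        simpa using hpair 2 (by simpa using h)
      rw [← inv_mem_iff, ← mk0_eq_inv_of_mul_eq_span_singleton (I := J) (x := ω - 7)
        (by rw [hJ, hP5, span_three_mul_span_five' hω])]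
      exact hJmem
  · exact hanis (by decide)

theorem orderOf_mk0_span_three (hω : ω ^ 2 = ω + 57)
    (hindep : ∀ a b : ℤ, (a : R) + b * ω = 0 → a = 0 ∧ b = 0)
    (hspan : ∀ x : R, ∃ a b : ℤ, x = a + b * ω) {I : (Ideal R)⁰}
    (hI : (I : Ideal R) = Ideal.span {3, ω}) : orderOf (ClassGroup.mk0 I) = 3 := by
  refine orderOf_eq_prime ?_ fun h ↦ ?_
  · rw [← map_pow]
    exact mk0_eq_one_of_eq_span_singleton (x := ω - 6)
      (by rw [SubmonoidClass.coe_pow, hI, span_three_cubed hω])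
  · exact not_isPrincipal_span_three hω hindep hspan (hI ▸ (ClassGroup.mk0_eq_one_iff I.2).mp h)

end QuadraticOrder

theorem exists_prime_dvd_absNorm_mem {K : Type*} [Field K] [NumberField K] (P : (Ideal (𝓞 K))⁰)
    [(P : Ideal (𝓞 K)).IsPrime] :
    ∃ p : ℕ, p.Prime ∧ p ∣ Ideal.absNorm (P : Ideal (𝓞 K)) ∧ (p : 𝓞 K) ∈ (P : Ideal (𝓞 K)) := by
  have : NeZero (P : Ideal (𝓞 K)) := ⟨nonZeroDivisors.coe_ne_zero P⟩
  exact ⟨_, Nat.absNorm_under_prime (P : Ideal (𝓞 K)), Int.absNorm_under_dvd_absNorm _,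
    Int.absNorm_under_mem _⟩

section RingOfIntegers

variable {K : Type*} [Field K] [NumberField K] {ω : 𝓞 K}

/-- A `ℤ`-basis `1, ω` of the ring of integers with `ω² = ω + 57` identifies it with
`ℤ[X] / (X² - X - 57)`. -/
noncomputable def quadraticAlgebraEquiv (hω : ω ^ 2 = ω + 57)
    (hindep : ∀ a b : ℤ, (a : 𝓞 K) + b * ω = 0 → a = 0 ∧ b = 0)
    (hspan : ∀ x : 𝓞 K, ∃ a b : ℤ, x = a + b * ω) : QuadraticAlgebra ℤ 57 1 ≃ₐ[ℤ] 𝓞 K :=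
  AlgEquiv.ofBijective
    (QuadraticAlgebra.lift ⟨ω, by
      rw [← sq, hω]
      simp [add_comm]⟩) (by
    constructor
    · refine (injective_iff_map_eq_zero _).mpr fun x hx ↦ ?_
      have := hindep x.re x.im (by simpa [QuadraticAlgebra.lift] using hx)
      exact QuadraticAlgebra.ext this.1 this.2
    · intro x
      obtain ⟨a, b, rfl⟩ := hspan x
      exact ⟨⟨a, b⟩, by simp [QuadraticAlgebra.lift]⟩)

theorem QuadraticAlgebra.trace_eq {R : Type*} [CommRing R] {a b : R} (x : QuadraticAlgebra R a b) :
    Algebra.trace R (QuadraticAlgebra R a b) x = 2 * x.re + b * x.im := by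
  rw [Algebra.trace_eq_matrix_trace (QuadraticAlgebra.basis a b), Matrix.trace, Fin.sum_univ_two]
  simp only [Matrix.diag, Algebra.leftMulMatrix_eq_repr_mul]
  simp [QuadraticAlgebra.basis]
  ring

theorem finrank_eq_two (hω : ω ^ 2 = ω + 57)
    (hindep : ∀ a b : ℤ, (a : 𝓞 K) + b * ω = 0 → a = 0 ∧ b = 0)
    (hspan : ∀ x : 𝓞 K, ∃ a b : ℤ, x = a + b * ω) : Module.finrank ℚ K = 2 := by
  rw [← RingOfIntegers.rank, ← (quadraticAlgebraEquiv hω hindep hspan).toLinearEquiv.finrank_eq,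
    QuadraticAlgebra.finrank_eq_two]

theorem discr_eq_229 (hω : ω ^ 2 = ω + 57)
    (hindep : ∀ a b : ℤ, (a : 𝓞 K) + b * ω = 0 → a = 0 ∧ b = 0)
    (hspan : ∀ x : 𝓞 K, ∃ a b : ℤ, x = a + b * ω) : discr K = 229 := by
  have e := quadraticAlgebraEquiv hω hindep hspan
  rw [← discr_eq_discr _ ((QuadraticAlgebra.basis 57 1).map e.toLinearEquiv)]
  have : ⇑((QuadraticAlgebra.basis (57 : ℤ) 1).map e.toLinearEquiv) =
    e ∘ QuadraticAlgebra.basis (57 : ℤ) 1 := by ext; simp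
  rw [this, ← Algebra.discr_eq_discr_of_algEquiv, Algebra.discr_def, Matrix.det_fin_two]
  simp only [Algebra.traceMatrix_apply, Algebra.traceForm_apply, QuadraticAlgebra.trace_eq]
  simp [QuadraticAlgebra.basis]

/-- A number field whose ring of integers is `ℤ[ω]` with `ω² = ω + 57` has class number `3`. -/
theorem classNumber_eq_three (hω : ω ^ 2 = ω + 57)
    (hindep : ∀ a b : ℤ, (a : 𝓞 K) + b * ω = 0 → a = 0 ∧ b = 0)
    (hspan : ∀ x : 𝓞 K, ∃ a b : ℤ, x = a + b * ω) : classNumber K = 3 := by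
  have hrank := finrank_eq_two hω hindep hspan
  have hdiscr := discr_eq_229 hω hindep hspan
  have hcomplex : InfinitePlace.nrComplexPlaces K = 0 := by
    have hcard := InfinitePlace.card_add_two_mul_card_eq_rank K
    have hsign := sign_discr K
    rw [hrank] at hcard
    rw [hdiscr] at hsign
    obtain h | h : InfinitePlace.nrComplexPlaces K = 0 ∨ InfinitePlace.nrComplexPlaces K = 1 := by
      omega
    · exact h
    · rw [h] at hsign
      exact absurd hsign (by decide)
  have hbound : (4 / Real.pi) ^ InfinitePlace.nrComplexPlaces K *
      ((Module.finrank ℚ K).factorial / (Module.finrank ℚ K) ^ Module.finrank ℚ K *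
        √|discr K|) < (7 : ℕ) + 1 := by
    rw [hcomplex, hrank, hdiscr]
    have : √(229 : ℝ) < 16 := (Real.sqrt_lt' (by norm_num)).mpr (by norm_num)
    norm_num [Nat.factorial]
    linarith
  obtain ⟨I, hI⟩ : ∃ I : (Ideal (𝓞 K))⁰, (I : Ideal (𝓞 K)) = Ideal.span {3, ω} :=
    ⟨⟨Ideal.span {3, ω}, mem_nonZeroDivisors_of_ne_zero (by simp)⟩, rfl⟩
  have htop : Subgroup.zpowers (ClassGroup.mk0 I) = ⊤ := by
    refine Subgroup.eq_top_of_mk0_mem _ hbound fun P hP hP7 ↦ ?_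
    obtain ⟨p, hp, hpdvd, hpP⟩ := exists_prime_dvd_absNorm_mem P
    exact mk0_mem_zpowers hω hspan hI hP hp
      ((Nat.le_of_dvd (Ideal.absNorm_pos_of_nonZeroDivisors P) hpdvd).trans hP7) hpP
  rw [classNumber, ← Nat.card_eq_fintype_card, ← Subgroup.card_top, ← htop, Nat.card_zpowers,
    orderOf_mk0_span_three hω hindep hspan hI]

end RingOfIntegers

section SqrtField

theorem exists_int_eq_of_mul_sq_eq {r : ℚ} {n : ℤ} (h : 229 * r ^ 2 = n) : ∃ k : ℤ, r = k := by
  have hint : IsIntegral ℤ (229 * r) := by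
    refine IsIntegral.of_pow two_pos ?_
    rw [show (229 * r) ^ 2 = algebraMap ℤ ℚ (229 * n) by
      rw [eq_intCast]
      push_cast
      linear_combination 229 * h]
    exact isIntegral_algebraMap
  obtain ⟨t, ht⟩ := IsIntegrallyClosed.isIntegral_iff.mp hint
  simp only [algebraMap_int_eq, eq_intCast] at ht
  have ht2 : t ^ 2 = 229 * n := by
    have : (t : ℚ) ^ 2 = 229 * n := by rw [ht]; linear_combination 229 * h
    exact_mod_cast this
  obtain ⟨k, rfl⟩ := Int.Prime.dvd_pow' (p := 229) (by norm_num) (ht2 ▸ dvd_mul_right _ _)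
  refine ⟨k, ?_⟩
  push_cast at ht
  linarith

variable {K : Type*} [Field K] [CharZero K] {θ : K}

theorem rat_coords_eq_zero (hθ : θ ^ 2 = 229) {p q : ℚ} (h : (p : K) + q * θ = 0) :
    p = 0 ∧ q = 0 := by
  have hpq : p ^ 2 = 229 * q ^ 2 := by
    have : (p : K) ^ 2 = 229 * q ^ 2 := by
      linear_combination (p - q * θ) * h + q ^ 2 * hθ
    exact_mod_cast this
  have hq : q = 0 := by
    by_contra hq
    refine (X_pow_sub_C_irreducible_iff_of_prime Nat.prime_two).mp
      irreducible_X_sq_sub_229 (p / q) ?_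
    field_simp
    linear_combination hpq
  simp_all

/-- The ring of integers of `ℚ(√229)` is spanned by `1` and `(1 + √229) / 2`. -/
theorem exists_int_coords (hθ : θ ^ 2 = 229) (σ : K →+* K) (hσ : σ θ = -θ) {p q : ℚ}
    (hx : IsIntegral ℤ (p + q * θ)) :
    ∃ a b : ℤ, p + q * θ = a + b * ((1 + θ) / 2) := by
  have hx' : IsIntegral ℤ (p - q * θ) := by
    simpa [hσ, sub_eq_add_neg] using map_isIntegral_int σ hx
  have hint (r : ℚ) (hr : IsIntegral ℤ (r : K)) : ∃ n : ℤ, n = r :=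
    IsIntegrallyClosed.isIntegral_iff.mp
      ((isIntegral_algebraMap_iff (algebraMap ℚ K).injective).mp (by simpa using hr))
  obtain ⟨m, hm⟩ := hint (2 * p) (by
    rw [show ((2 * p : ℚ) : K) = p + q * θ + (p - q * θ) by push_cast; ring]
    exact hx.add hx')
  obtain ⟨N, hN⟩ := hint (p ^ 2 - 229 * q ^ 2) (by
    rw [show ((p ^ 2 - 229 * q ^ 2 : ℚ) : K) = (p + q * θ) * (p - q * θ) by
      push_cast
      linear_combination (q : K) ^ 2 * hθ]
    exact hx.mul hx')
  obtain ⟨n, hn⟩ := exists_int_eq_of_mul_sq_eq (r := 2 * q) (n := m ^ 2 - 4 * N) (by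
    push_cast
    rw [hm, hN]
    ring)
  have hmn : m ^ 2 - 229 * n ^ 2 = 4 * N := by
    have : (m ^ 2 - 229 * n ^ 2 : ℚ) = 4 * N := by rw [hm, hN, ← hn]; ring
    exact_mod_cast this
  obtain ⟨a, ha⟩ : (2 : ℤ) ∣ m - n := by
    rw [← even_iff_two_dvd]
    have : Even (m ^ 2 - 229 * n ^ 2) := hmn ▸ ⟨2 * N, by ring⟩
    simp only [parity_simps] at this ⊢
    have h229 : ¬ Even (229 : ℤ) := by decide
    simp_all
  refine ⟨a, n, ?_⟩
  obtain rfl : p = a + n / 2 := by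
    have : (m - n : ℚ) = 2 * a := by exact_mod_cast ha
    linarith
  obtain rfl : q = n / 2 := by linarith
  push_cast
  ring

theorem isIntegral_half_one_add (hθ : θ ^ 2 = 229) : IsIntegral ℤ ((1 + θ) / 2) := by
  refine ⟨X ^ 2 - X - C (57 : ℤ), by monicity!, ?_⟩
  simp only [algebraMap_int_eq, eval₂_sub, eval₂_X_pow, eval₂_X, eval₂_C,
    Int.coe_castRingHom, Int.cast_ofNat]
  linear_combination hθ / 4

end SqrtField

theorem classNumber_eq_three_of_sq_eq_229 {K : Type*} [Field K] [NumberField K] {θ : K}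
    (hθ : θ ^ 2 = 229)
    (hspan : ∀ x : K, ∃ p q : ℚ, x = p + q * θ) (σ : K →+* K) (hσ : σ θ = -θ) :
    classNumber K = 3 := by
  obtain ⟨ω, hω⟩ : ∃ ω : 𝓞 K, (ω : K) = (1 + θ) / 2 := ⟨⟨_, isIntegral_half_one_add hθ⟩, rfl⟩
  refine classNumber_eq_three (ω := ω) ?_ (fun a b h ↦ ?_) fun x ↦ ?_
  · refine RingOfIntegers.ext ?_
    simp only [map_pow, map_add, map_ofNat, hω]
    linear_combination hθ / 4
  · have h' := congrArg (algebraMap (𝓞 K) K) h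
    simp only [map_add, map_mul, map_intCast, hω, map_zero] at h'
    obtain ⟨h1, h2⟩ := rat_coords_eq_zero hθ (p := a + b / 2) (q := b / 2) (by
      push_cast
      linear_combination h')
    have hb : (b : ℚ) = 0 := by linarith
    have ha : (a : ℚ) = 0 := by linarith
    exact_mod_cast And.intro ha hb
  · obtain ⟨p, q, hpq⟩ := hspan x
    obtain ⟨a, b, h⟩ := exists_int_coords hθ σ hσ (by
      rw [← hpq]
      exact x.isIntegral_coe)
    exact ⟨a, b, RingOfIntegers.ext (by simpa [hω, hpq] using h)⟩

theorem AdjoinRoot.exists_rat_coords (x : AdjoinRoot (X ^ 2 - C (229 : ℚ))) :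
    ∃ p q : ℚ, x = (p : AdjoinRoot (X ^ 2 - C (229 : ℚ))) +
      (q : AdjoinRoot (X ^ 2 - C (229 : ℚ))) * AdjoinRoot.root (X ^ 2 - C (229 : ℚ)) := by
  have hmonic : (X ^ 2 - C (229 : ℚ)).Monic := monic_X_pow_sub_C _ two_ne_zero
  have hdeg : (X ^ 2 - C (229 : ℚ)).natDegree = 2 := natDegree_X_pow_sub_C
  obtain ⟨f, rfl⟩ := AdjoinRoot.mk_surjective x
  have hlt := natDegree_modByMonic_lt f hmonic (ne_of_apply_ne natDegree (by simp))
  rw [hdeg] at hlt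
  obtain ⟨q, p, hpq⟩ := exists_eq_X_add_C_of_natDegree_le_one (Nat.le_of_lt_succ hlt)
  refine ⟨p, q, ?_⟩
  have hmk : AdjoinRoot.mk (X ^ 2 - C (229 : ℚ)) f =
      AdjoinRoot.mk (X ^ 2 - C (229 : ℚ)) (f %ₘ (X ^ 2 - C (229 : ℚ))) :=
    AdjoinRoot.mk_eq_mk.mpr ⟨f /ₘ (X ^ 2 - C (229 : ℚ)), by
      linear_combination -(modByMonic_add_div f (X ^ 2 - C (229 : ℚ)))⟩
  rw [hmk, hpq]
  simp [add_comm]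

/-- The real quadratic field `ℚ(√229)`, realized as `AdjoinRoot (X² - 229)`,
has class number `3`. -/
theorem classNumber_sqrt229_eq_three :
    NumberField.classNumber (AdjoinRoot (X ^ 2 - C (229 : ℚ))) = 3 := by
  have hroot : AdjoinRoot.root (X ^ 2 - C (229 : ℚ)) ^ 2 = 229 := by
    have := AdjoinRoot.eval₂_root (X ^ 2 - C (229 : ℚ))
    simpa [sub_eq_zero] using this
  refine classNumber_eq_three_of_sq_eq_229 hroot AdjoinRoot.exists_rat_coords
    (AdjoinRoot.lift (algebraMap ℚ _) (-AdjoinRoot.root (X ^ 2 - C (229 : ℚ))) ?_)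
    (AdjoinRoot.lift_root _)
  simp [hroot]
end

section
/- Let K be the splitting field of X³ − 4X + 1 over ℚ, let x ∈ K be a root of X³ − 4X + 1, and let y ∈ K satisfy y² = 229. Let ε = (15 + y)/2 ∈ K. Then ε, and σ(x) and σ(x) − 2 for every σ ∈ Gal(K/ℚ), are units of 𝓞_K, and the subgroup of the unit group (𝓞_K)^× generated by ε together with all σ(x) and σ(x) − 2 (σ ranging over Gal(K/ℚ)) has finite index in (𝓞_K)^×. -/
open Polynomial NumberField

/-- The splitting field `K` of `X³ - 4X + 1` over `ℚ`. -/
def SplF : Type := (X ^ 3 - 4 * X + 1 : ℚ[X]).SplittingField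

noncomputable instance : Field SplF :=
  inferInstanceAs (Field (X ^ 3 - 4 * X + 1 : ℚ[X]).SplittingField)

noncomputable instance : Algebra ℚ SplF :=
  inferInstanceAs (Algebra ℚ (X ^ 3 - 4 * X + 1 : ℚ[X]).SplittingField)

/-- Enough `ℤ`-independent elements of a finitely generated commutative group generate a subgroup
of finite index. -/
theorem finiteIndex_closure_range_of_linearIndependent {G ι : Type*} [CommGroup G] [Fintype ι]
    [Module.Finite ℤ (Additive G)] (v : ι → G)
    (hv : LinearIndependent ℤ fun i ↦ Additive.ofMul (v i))
    (hrank : Module.finrank ℤ (Additive G) ≤ Fintype.card ι) :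
    (Subgroup.closure (Set.range v)).FiniteIndex := by
  set N : Submodule ℤ (Additive G) := Submodule.span ℤ (Set.range fun i ↦ Additive.ofMul (v i))
    with hN
  have hquot : Module.finrank ℤ (Additive G ⧸ N) = 0 := by
    have h := N.finrank_quotient_add_finrank
    have hc : Module.finrank ℤ N = Fintype.card ι := finrank_span_eq_card hv
    omega
  have : Finite (Additive G ⧸ N) :=
    Module.finite_of_fg_torsion _ (Module.finrank_eq_zero_iff_isTorsion.mp hquot)
  have hNc : N.toAddSubgroup = (Subgroup.closure (Set.range v)).toAddSubgroup := by
    rw [hN, Submodule.span_int_eq_addSubgroupClosure, Subgroup.toAddSubgroup_closure]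
    rfl
  rw [← Subgroup.finiteIndex_toAddSubgroup_iff, ← hNc]
  exact AddSubgroup.finiteIndex_iff_finite_quotient.mpr this

theorem NumberField.Units.rank_le_finrank_sub_one (K : Type*) [Field K] [NumberField K] :
    Units.rank K ≤ Module.finrank ℚ K - 1 := by
  have h₁ := InfinitePlace.card_eq_nrRealPlaces_add_nrComplexPlaces K
  have h₂ := InfinitePlace.card_add_two_mul_card_eq_rank K
  rw [Units.rank]
  omega

theorem NumberField.RingOfIntegers.exists_unit_of_mul_eq_one {K : Type*} [Field K] {u v : K}
    (hu : IsIntegral ℤ u) (hv : IsIntegral ℤ v) (h : u * v = 1) :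
    ∃ w : (𝓞 K)ˣ, ((w : 𝓞 K) : K) = u :=
  ⟨Units.mkOfMulEqOne (⟨u, hu⟩ : 𝓞 K) ⟨v, hv⟩ (RingOfIntegers.ext h), rfl⟩

section Units

variable {K : Type*} [Field K]

theorem isIntegral_ofNat (n : ℕ) [n.AtLeastTwo] : IsIntegral ℤ (ofNat(n) : K) := by
  rw [← map_ofNat (algebraMap ℤ K) n]
  exact isIntegral_algebraMap

theorem isIntegral_of_cubic {z : K} (hz : z ^ 3 - 4 * z + 1 = 0) : IsIntegral ℤ z :=
  ⟨X ^ 3 - 4 * X + 1, by monicity!, by simpa [eval₂_ofNat] using hz⟩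

theorem exists_unit_eq_root {z : K} (hz : z ^ 3 - 4 * z + 1 = 0) :
    ∃ u : (𝓞 K)ˣ, ((u : 𝓞 K) : K) = z := by
  have hi := isIntegral_of_cubic hz
  exact RingOfIntegers.exists_unit_of_mul_eq_one (v := 4 - z ^ 2) hi
    ((isIntegral_ofNat 4).sub (hi.pow 2)) (by linear_combination -hz)

theorem exists_unit_eq_root_sub_two {z : K} (hz : z ^ 3 - 4 * z + 1 = 0) :
    ∃ u : (𝓞 K)ˣ, ((u : 𝓞 K) : K) = z - 2 := by
  have hi := isIntegral_of_cubic hz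
  have h2 : IsIntegral ℤ (2 : K) := isIntegral_ofNat 2
  exact RingOfIntegers.exists_unit_of_mul_eq_one (v := -(z * (z + 2))) (hi.sub h2)
    (hi.mul (hi.add h2)).neg (by linear_combination -hz)

theorem exists_unit_eq_of_sq [CharZero K] {y : K} (hy : y ^ 2 = 229) :
    ∃ u : (𝓞 K)ˣ, ((u : 𝓞 K) : K) = (15 + y) / 2 := by
  have he : ((15 + y) / 2) ^ 2 - 15 * ((15 + y) / 2) - 1 = 0 := by linear_combination hy / 4
  have hi : IsIntegral ℤ ((15 + y) / 2) :=
    ⟨X ^ 2 - 15 * X - 1, by monicity!, by simpa [eval₂_ofNat] using he⟩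
  exact RingOfIntegers.exists_unit_of_mul_eq_one (v := (15 + y) / 2 - 15) hi
    (hi.sub (isIntegral_ofNat 15)) (by linear_combination he)

end Units

section Roots

variable {K : Type*} [Field K]

theorem exists_cubic_factorization [Algebra ℚ K]
    [IsSplittingField ℚ K (X ^ 3 - 4 * X + 1 : ℚ[X])] {a : K}
    (ha : a ^ 3 - 4 * a + 1 = 0) :
    ∃ b c : K, ∀ t : K, t ^ 3 - 4 * t + 1 = (t - a) * (t - b) * (t - c) := by
  have hm : (X ^ 3 - 4 * X + 1 : ℚ[X]).Monic := by monicity!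
  have hs := IsSplittingField.splits K (X ^ 3 - 4 * X + 1 : ℚ[X])
  have hmem : a ∈ (X ^ 3 - 4 * X + 1 : ℚ[X]).aroots K := by
    rw [mem_aroots]
    exact ⟨hm.ne_zero, by simpa [map_ofNat] using ha⟩
  obtain ⟨s, hs'⟩ := Multiset.exists_cons_of_mem hmem
  have hcard := hs.natDegree_eq_card_roots
  rw [natDegree_map, show (X ^ 3 - 4 * X + 1 : ℚ[X]).natDegree = 3 by compute_degree!] at hcard
  change 3 = ((X ^ 3 - 4 * X + 1 : ℚ[X]).aroots K).card at hcard
  rw [hs', Multiset.card_cons] at hcard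
  obtain ⟨b, c, rfl⟩ := Multiset.card_eq_two.mp (show s.card = 2 by omega)
  refine ⟨b, c, fun t ↦ ?_⟩
  have h := hs.aeval_eq_prod_aroots_of_monic hm t
  simpa [hs', mul_assoc, map_ofNat] using h

variable {a b c : K}

theorem sum_roots_eq_zero [CharZero K]
    (h : ∀ t : K, t ^ 3 - 4 * t + 1 = (t - a) * (t - b) * (t - c)) : a + b + c = 0 := by
  linear_combination (h 1 + h (-1)) / 2 - h 0

theorem prod_roots (h : ∀ t : K, t ^ 3 - 4 * t + 1 = (t - a) * (t - b) * (t - c)) :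
    a * b * c = -1 := by
  linear_combination h 0

theorem prod_roots_sub_two (h : ∀ t : K, t ^ 3 - 4 * t + 1 = (t - a) * (t - b) * (t - c)) :
    (a - 2) * (b - 2) * (c - 2) = -1 := by
  linear_combination h 2

theorem roots_ne [CharZero K]
    (h : ∀ t : K, t ^ 3 - 4 * t + 1 = (t - a) * (t - b) * (t - c)) : a ≠ b := by
  rintro rfl
  have h₀ := sum_roots_eq_zero h
  obtain rfl : c = -2 * a := by linear_combination h₀
  have h₁ : 3 * a ^ 2 = 4 := by linear_combination h 1 - h 0
  have h₂ : 2 * a ^ 3 = 1 := by linear_combination - h 0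
  have h₃ : (256 : K) = 27 := by
    linear_combination -4 * ((3 * a ^ 2) ^ 2 + 4 * (3 * a ^ 2) + 16) * h₁ + 27 * (2 * a ^ 3 + 1) * h₂
  norm_num at h₃

end Roots

theorem natDegree_dvd_finrank_of_irreducible {F K : Type*} [Field F] [Field K] [Algebra F K]
    [FiniteDimensional F K] {p : F[X]} (hp : Irreducible p) (hm : p.Monic) {z : K}
    (hz : aeval z p = 0) : p.natDegree ∣ Module.finrank F K := by
  rw [minpoly.eq_of_irreducible_of_monic hp hz hm]
  exact minpoly.degree_dvd (.of_finite F z)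

theorem irreducible_cubic : Irreducible (X ^ 3 - 4 * X + 1 : ℚ[X]) := by
  have hm : (X ^ 3 - 4 * X + 1 : ℚ[X]).Monic := by monicity!
  have hd : (X ^ 3 - 4 * X + 1 : ℚ[X]).natDegree = 3 := by compute_degree!
  rw [hm.irreducible_iff_roots_eq_zero_of_degree_le_three (by omega) (by omega),
    Multiset.eq_zero_iff_forall_notMem]
  intro r hr
  have hr0 : r ^ 3 - 4 * r + 1 = 0 := by simpa using (mem_roots'.mp hr).2
  obtain ⟨n, rfl⟩ := IsIntegrallyClosed.isIntegral_iff.mp (isIntegral_of_cubic hr0)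
  simp only [eq_intCast] at hr0
  have hn : n * (4 - n ^ 2) = 1 := by
    have : ((n * (4 - n ^ 2) : ℤ) : ℚ) = 1 := by push_cast; linear_combination -hr0
    exact_mod_cast this
  rcases Int.isUnit_iff.mp (IsUnit.of_mul_eq_one _ hn) with rfl | rfl <;> norm_num at hn

theorem irreducible_sq_sub_229 : Irreducible (X ^ 2 - 229 : ℚ[X]) := by
  have hm : (X ^ 2 - 229 : ℚ[X]).Monic := by monicity!
  have hd : (X ^ 2 - 229 : ℚ[X]).natDegree = 2 := by compute_degree!
  rw [hm.irreducible_iff_roots_eq_zero_of_degree_le_three (by omega) (by omega),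
    Multiset.eq_zero_iff_forall_notMem]
  intro r hr
  have hr0 : r ^ 2 - 229 = 0 := by simpa using (mem_roots'.mp hr).2
  have hirr : Irrational √(229 : ℕ) := Nat.Prime.irrational_sqrt (by norm_num)
  refine hirr ⟨|r|, ?_⟩
  rw [eq_comm, Real.sqrt_eq_iff_mul_self_eq (by positivity) (by positivity), ← sq]
  have : |r| ^ 2 = 229 := by rw [sq_abs]; linarith
  exact_mod_cast this.symm

section Galois

variable {K : Type*} [Field K] [CharZero K] [Algebra ℚ K]
  {a b c y : K}

theorem map_root_mem [DecidableEq K]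
    (h : ∀ t : K, t ^ 3 - 4 * t + 1 = (t - a) * (t - b) * (t - c))
    (σ : K ≃ₐ[ℚ] K) {z : K} (hz : z ∈ ({a, b, c} : Finset K)) : σ z ∈ ({a, b, c} : Finset K) := by
  have hiff (w : K) : w ∈ ({a, b, c} : Finset K) ↔ w ^ 3 - 4 * w + 1 = 0 := by
    simp [h w, sub_eq_zero, or_assoc]
  rw [hiff] at hz ⊢
  simpa [map_ofNat] using congrArg σ hz

variable [IsSplittingField ℚ K (X ^ 3 - 4 * X + 1 : ℚ[X])]

theorem algEquiv_ext_of_roots (h : ∀ t : K, t ^ 3 - 4 * t + 1 = (t - a) * (t - b) * (t - c))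
    {σ τ : K ≃ₐ[ℚ] K} (ha : σ a = τ a) (hb : σ b = τ b) : σ = τ := by
  have hsum := sum_roots_eq_zero h
  have hc : σ c = τ c := by
    rw [show c = -a - b by linear_combination hsum]
    simp [ha, hb]
  suffices (σ : K →ₐ[ℚ] K) = τ from AlgEquiv.coe_toAlgHom_injective this
  refine AlgHom.ext_of_adjoin_eq_top
    (IsSplittingField.adjoin_rootSet K (X ^ 3 - 4 * X + 1 : ℚ[X])) fun z hz ↦ ?_
  have hz0 : z ^ 3 - 4 * z + 1 = 0 := by simpa [map_ofNat] using (mem_rootSet.mp hz).2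
  rw [h z, mul_eq_zero, mul_eq_zero, sub_eq_zero, sub_eq_zero, sub_eq_zero] at hz0
  rcases hz0 with (rfl | rfl) | rfl <;> simpa

/-- `K` has degree six, and its automorphisms realise all the ordered pairs of distinct roots. -/
theorem finrank_eq_six_and_exists_algEquiv
    (h : ∀ t : K, t ^ 3 - 4 * t + 1 = (t - a) * (t - b) * (t - c)) (hy : y ^ 2 = 229) :
    Module.finrank ℚ K = 6 ∧ ∀ u v : K, (u = a ∨ u = b ∨ u = c) → (v = a ∨ v = b ∨ v = c) →
      u ≠ v → ∃ σ : K ≃ₐ[ℚ] K, σ a = u ∧ σ b = v := by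
  classical
  have : FiniteDimensional ℚ K := IsSplittingField.finiteDimensional K (X ^ 3 - 4 * X + 1 : ℚ[X])
  have : IsGalois ℚ K := .of_separable_splitting_field (irreducible_cubic.separable)
  have hab : a ≠ b := roots_ne h
  have hac : a ≠ c := roots_ne (c := b) fun t ↦ by rw [h t]; ring
  have hbc : b ≠ c := roots_ne (c := a) fun t ↦ by rw [h t]; ring
  set S : Finset K := {a, b, c} with hS
  have hScard : S.offDiag.card = 6 := by
    rw [Finset.offDiag_card, Finset.card_eq_three.mpr ⟨a, b, c, hab, hac, hbc, hS⟩]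
  have hmaps : ∀ σ ∈ (Finset.univ : Finset (K ≃ₐ[ℚ] K)), (σ a, σ b) ∈ S.offDiag := fun σ _ ↦ by
    rw [Finset.mem_offDiag]
    exact ⟨map_root_mem h σ (by simp), map_root_mem h σ (by simp), by simpa using hab⟩
  have hinj : ∀ σ ∈ (Finset.univ : Finset (K ≃ₐ[ℚ] K)), ∀ τ ∈ Finset.univ,
      (σ a, σ b) = (τ a, τ b) → σ = τ := fun σ _ τ _ heq ↦
    algEquiv_ext_of_roots h (Prod.ext_iff.mp heq).1 (Prod.ext_iff.mp heq).2
  have haut : (Finset.univ : Finset (K ≃ₐ[ℚ] K)).card = Module.finrank ℚ K := by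
    rw [← IsGalois.card_aut_eq_finrank ℚ K, Nat.card_eq_fintype_card, Finset.card_univ]
  have hle : Module.finrank ℚ K ≤ 6 := by
    rw [← haut, ← hScard]
    exact Finset.card_le_card_of_injOn _ hmaps hinj
  have h₃ : 3 ∣ Module.finrank ℚ K := by
    rw [← show (X ^ 3 - 4 * X + 1 : ℚ[X]).natDegree = 3 by compute_degree!]
    exact natDegree_dvd_finrank_of_irreducible irreducible_cubic (by monicity!)
      (z := a) (by simpa [map_ofNat] using h a)
  have h₂ : 2 ∣ Module.finrank ℚ K := by
    rw [← show (X ^ 2 - 229 : ℚ[X]).natDegree = 2 by compute_degree!]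
    exact natDegree_dvd_finrank_of_irreducible irreducible_sq_sub_229 (by monicity!)
      (z := y) (by simp [hy, map_ofNat])
  have hpos : 0 < Module.finrank ℚ K := Module.finrank_pos
  have hsix : Module.finrank ℚ K = 6 := by omega
  refine ⟨hsix, fun u v hu hv huv ↦ ?_⟩
  obtain ⟨σ, -, hσ⟩ := Finset.surj_on_of_inj_on_of_card_le (s := Finset.univ) (t := S.offDiag)
    (fun (σ : K ≃ₐ[ℚ] K) _ ↦ (σ a, σ b)) hmaps (fun σ τ hs ht heq ↦ hinj σ hs τ ht heq)
    (by rw [haut, hScard, hsix]) (u, v) (by simp [hS, hu, hv, huv])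
  exact ⟨σ, (Prod.ext_iff.mp hσ).1.symm, (Prod.ext_iff.mp hσ).2.symm⟩

/-- An automorphism permuting the roots cyclically fixes `√229`. -/
theorem cyclic_algEquiv_apply_sqrt
    (h : ∀ t : K, t ^ 3 - 4 * t + 1 = (t - a) * (t - b) * (t - c)) (hy : y ^ 2 = 229)
    {τ : K ≃ₐ[ℚ] K} (ha : τ a = b) (hb : τ b = c) (hc : τ c = a) : τ y = y := by
  have hcube : τ * τ * τ = 1 := algEquiv_ext_of_roots h
    (by simp [ha, hb, hc]) (by simp [ha, hb, hc])
  have hτ : τ y = y ∨ τ y = -y := by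
    rw [← sq_eq_sq_iff_eq_or_eq_neg, ← map_pow, hy, map_ofNat]
  refine hτ.resolve_right fun hneg ↦ ?_
  have hy' : -y = y := by
    simpa [hneg] using DFunLike.congr_fun hcube y
  have hy0 : y = 0 := by linear_combination -hy' / 2
  simp [hy0] at hy

end Galois

section Independence

theorem eq_zero_of_zpow_mul_zpow_eq_one {α β γ δ : ℝ}
    (hα : 0 < α) (hα' : α < 1) (hβ : 1 < β) (hγ : 1 < γ)
    (hδ : 1 < δ) {p r : ℤ} (h₁ : α ^ p * β ^ r = 1) (h₂ : γ ^ p * δ ^ r = 1) : p = 0 ∧ r = 0 := by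
  have l₁ := congrArg Real.log h₁
  have l₂ := congrArg Real.log h₂
  rw [Real.log_mul (by positivity) (by positivity), Real.log_zpow, Real.log_zpow,
    Real.log_one] at l₁ l₂
  have hA := Real.log_neg hα hα'
  have hB := Real.log_pos hβ
  have hC := Real.log_pos hγ
  have hD := Real.log_pos hδ
  have hr : (r : ℝ) = 0 := by
    have hdet : 0 < Real.log β * Real.log γ - Real.log α * Real.log δ := by nlinarith
    refine (mul_eq_zero.mp ?_).resolve_right hdet.ne'
    linear_combination Real.log γ * l₁ - Real.log α * l₂
  have hp : (p : ℝ) = 0 := by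
    refine (mul_eq_zero.mp ?_).resolve_right hC.ne'
    rw [hr] at l₂
    linear_combination l₂
  exact ⟨by exact_mod_cast hp, by exact_mod_cast hr⟩

variable {K : Type*} [Field K] [CharZero K] {a b c y : K}

/-- Every real root of `X³ - 4X + 1` is the image of one of `a`, `b`, `c`. -/
theorem exists_map_eq_real_root
    (h : ∀ t : K, t ^ 3 - 4 * t + 1 = (t - a) * (t - b) * (t - c)) (φ : K →+* ℂ) {s : ℝ}
    (hs : s ^ 3 - 4 * s + 1 = 0) : ∃ z, (z = a ∨ z = b ∨ z = c) ∧ φ z = s := by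
  have hsum := congrArg φ (sum_roots_eq_zero h)
  have hprod := congrArg φ (prod_roots h)
  have hprod₂ := congrArg φ (prod_roots_sub_two h)
  simp only [map_add, map_mul, map_sub, map_neg, map_one, map_zero, map_ofNat] at hsum hprod hprod₂
  have hs' : (s : ℂ) ^ 3 - 4 * s + 1 = 0 := by exact_mod_cast congrArg (fun x : ℝ ↦ (x : ℂ)) hs
  have hfac : ((s : ℂ) - φ a) * (s - φ b) * (s - φ c) = 0 := by
    linear_combination hs' + (2 * s - s ^ 2) * hsum + (s / 2 - 1) * hprod - s / 2 * hprod₂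
  rw [mul_eq_zero, mul_eq_zero, sub_eq_zero, sub_eq_zero, sub_eq_zero] at hfac
  rcases hfac with (hz | hz) | hz
  · exact ⟨a, by simp, hz.symm⟩
  · exact ⟨b, by simp, hz.symm⟩
  · exact ⟨c, by simp, hz.symm⟩

theorem eq_zero_of_root_zpow_mul_zpow
    (h : ∀ t : K, t ^ 3 - 4 * t + 1 = (t - a) * (t - b) * (t - c)) (φ : K →+* ℂ) {p r : ℤ}
    (hpr : ∀ z, (z = a ∨ z = b ∨ z = c) → (z ^ p * (z - 2) ^ r) ^ 6 = 1) : p = 0 ∧ r = 0 := by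
  have hcont (S : Set ℝ) : ContinuousOn (fun s : ℝ ↦ s ^ 3 - 4 * s + 1) S := by fun_prop
  obtain ⟨s, hs, hs0⟩ : (0 : ℝ) ∈ (fun s : ℝ ↦ s ^ 3 - 4 * s + 1) '' Set.Ioo 0 (1 / 2) :=
    intermediate_value_Ioo' (by norm_num) (hcont _) (by norm_num)
  obtain ⟨t, ht, ht0⟩ : (0 : ℝ) ∈ (fun s : ℝ ↦ s ^ 3 - 4 * s + 1) '' Set.Ioo (-3) (-2) :=
    intermediate_value_Ioo (by norm_num) (hcont _) (by norm_num)
  have habs {w : ℝ} (hw : w ^ 3 - 4 * w + 1 = 0) : |w| ^ p * |w - 2| ^ r = 1 := by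
    obtain ⟨z, hz, hφ⟩ := exists_map_eq_real_root h φ hw
    have hnorm := congrArg (fun x ↦ ‖φ x‖) (hpr z hz)
    simp only [map_pow, map_mul, map_zpow₀, map_sub, map_ofNat, map_one, norm_pow, norm_mul,
      norm_zpow, norm_one, hφ] at hnorm
    rw [← Complex.ofReal_ofNat, ← Complex.ofReal_sub, Complex.norm_real, Complex.norm_real,
      Real.norm_eq_abs, Real.norm_eq_abs] at hnorm
    exact (pow_eq_one_iff_of_nonneg (by positivity) (by norm_num)).mp hnorm
  obtain ⟨hs₁, hs₂⟩ := hs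
  obtain ⟨ht₁, ht₂⟩ := ht
  refine eq_zero_of_zpow_mul_zpow_eq_one ?_ ?_ ?_ ?_ ?_ (habs hs0) (habs ht0)
  · rw [abs_pos]; linarith
  · rw [abs_lt]; constructor <;> linarith
  · rw [lt_abs]; right; linarith
  · rw [lt_abs]; right; linarith
  · rw [lt_abs]; right; linarith

theorem norm_ne_one_of_sq (hy : y ^ 2 = 229) (φ : K →+* ℂ) : ‖φ ((15 + y) / 2)‖ ≠ 1 := by
  intro h1
  have he : ((15 + y) / 2) ^ 2 - 1 = 15 * ((15 + y) / 2) := by linear_combination hy / 4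
  have hφ := congrArg (fun x ↦ ‖φ x‖) he
  simp only [map_sub, map_pow, map_one, map_mul _ (15 : K), map_ofNat _ 15, norm_mul, h1] at hφ
  have hle := norm_sub_le (φ ((15 + y) / 2) ^ 2) 1
  rw [hφ, norm_pow, h1] at hle
  norm_num at hle

variable [Algebra ℚ K] [IsSplittingField ℚ K (X ^ 3 - 4 * X + 1 : ℚ[X])]

theorem eq_zero_of_zpow_mul_eq_one
    (h : ∀ t : K, t ^ 3 - 4 * t + 1 = (t - a) * (t - b) * (t - c)) (hy : y ^ 2 = 229)
    (φ : K →+* ℂ) {n p q r s : ℤ}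
    (hrel : ((15 + y) / 2) ^ n * a ^ p * b ^ q * (a - 2) ^ r * (b - 2) ^ s = 1) :
    n = 0 ∧ p = 0 ∧ q = 0 ∧ r = 0 ∧ s = 0 := by
  have hab : a ≠ b := roots_ne h
  have hac : a ≠ c := roots_ne (c := b) fun t ↦ by rw [h t]; ring
  have hbc : b ≠ c := roots_ne (c := a) fun t ↦ by rw [h t]; ring
  have hsum := sum_roots_eq_zero h
  set F : K → K := fun z ↦ z ^ p * (z - 2) ^ r with hF
  set G : K → K := fun z ↦ z ^ q * (z - 2) ^ s with hG
  have hmap (i j : ℤ) (σ : K ≃ₐ[ℚ] K) (z : K) :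
      σ (z ^ i * (z - 2) ^ j) = σ z ^ i * (σ z - 2) ^ j := by simp [map_ofNat]
  have hcube (i j : ℤ) :
      ((a ^ i * (a - 2) ^ j) * (b ^ i * (b - 2) ^ j) * (c ^ i * (c - 2) ^ j)) ^ 2 = 1 := by
    have hprod : (a ^ i * (a - 2) ^ j) * (b ^ i * (b - 2) ^ j) * (c ^ i * (c - 2) ^ j) =
        (a * b * c) ^ i * ((a - 2) * (b - 2) * (c - 2)) ^ j := by
      simp only [mul_zpow]; ring
    rw [hprod, prod_roots h, prod_roots_sub_two h, mul_pow, ← zpow_natCast, ← zpow_natCast,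
      zpow_comm, zpow_comm (-1) j]
    norm_num
  have hrel' : ((15 + y) / 2) ^ n * F a * G b = 1 := by rw [← hrel, hF, hG]; ring
  obtain ⟨-, hex⟩ := finrank_eq_six_and_exists_algEquiv h hy
  have hn : n = 0 := by
    obtain ⟨τ, ha, hb⟩ := hex b c (by simp) (by simp) hbc
    have hc : τ c = a := by
      rw [show c = -a - b by linear_combination hsum, map_sub, map_neg, ha, hb]
      linear_combination -hsum
    have hτ : τ (((15 + y) / 2) ^ n) = ((15 + y) / 2) ^ n := by
      simp [cyclic_algEquiv_apply_sqrt h hy ha hb hc, map_ofNat]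
    have h₁ := congrArg τ hrel'
    rw [map_mul, map_mul, hτ, hF, hG, hmap, hmap, ha, hb, map_one] at h₁
    have h₂ := congrArg τ h₁
    rw [map_mul, map_mul, hτ, hmap, hmap, hb, hc, map_one] at h₂
    have hε : (((15 + y) / 2) ^ n) ^ 6 = 1 := by
      calc _ = (((15 + y) / 2) ^ n) ^ 6 * (F a * F b * F c) ^ 2 * (G a * G b * G c) ^ 2 := by
            rw [hF, hG, hcube, hcube, mul_one, mul_one]
        _ = ((((15 + y) / 2) ^ n * F a * G b) * (((15 + y) / 2) ^ n * F b * G c) *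
              (((15 + y) / 2) ^ n * F c * G a)) ^ 2 := by ring
        _ = 1 := by rw [hrel', h₁, h₂]; norm_num
    have hnorm := congrArg (fun x ↦ ‖φ x‖) hε
    simp only [map_pow, map_zpow₀, norm_pow, norm_zpow, map_one, norm_one] at hnorm
    rw [pow_eq_one_iff_of_nonneg (by positivity) (by norm_num)] at hnorm
    exact (zpow_eq_one_iff_right₀ (norm_nonneg _) (norm_ne_one_of_sq hy φ)).mp hnorm
  have hFG (u v : K) (hu : u = a ∨ u = b ∨ u = c) (hv : v = a ∨ v = b ∨ v = c) (huv : u ≠ v) :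
      F u * G v = 1 := by
    obtain ⟨σ, rfl, rfl⟩ := hex u v hu hv huv
    have := congrArg σ hrel'
    rwa [hn, zpow_zero, one_mul, map_mul, hF, hG, hmap, hmap, map_one] at this
  have key (F G : K → K) (hFG : ∀ u v : K, (u = a ∨ u = b ∨ u = c) → (v = a ∨ v = b ∨ v = c) →
      u ≠ v → F u * G v = 1) (hF : (F a * F b * F c) ^ 2 = 1) (z : K)
      (hz : z = a ∨ z = b ∨ z = c) : F z ^ 6 = 1 := by
    have cancel {u v w : K} (h₁ : F u * G w = 1) (h₂ : F v * G w = 1) : F u = F v :=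
      mul_right_cancel₀ (right_ne_zero_of_mul_eq_one h₁) (h₁.trans h₂.symm)
    have e₁ : F a = F b := cancel (hFG a c (by simp) (by simp) hac) (hFG b c (by simp) (by simp) hbc)
    have e₂ : F a = F c :=
      cancel (hFG a b (by simp) (by simp) hab) (hFG c b (by simp) (by simp) hbc.symm)
    have hFa : F a ^ 6 = 1 := by
      rw [← hF, ← e₁, ← e₂]; ring
    rcases hz with rfl | rfl | rfl
    · exact hFa
    · rwa [← e₁]
    · rwa [← e₂]
  obtain ⟨hp, hr⟩ := eq_zero_of_root_zpow_mul_zpow h φ (key F G hFG (hcube p r))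
  obtain ⟨hq, hs⟩ := eq_zero_of_root_zpow_mul_zpow h φ
    (key G F (fun u v hu hv huv ↦ by rw [mul_comm]; exact hFG v u hv hu huv.symm) (hcube q s))
  exact ⟨hn, hp, hq, hr, hs⟩

end Independence

/-- The statement for an arbitrary splitting field of `X³ - 4X + 1`. -/
theorem units_closure_finiteIndex_of_isSplittingField {K : Type*} [Field K] [Algebra ℚ K]
    [IsSplittingField ℚ K (X ^ 3 - 4 * X + 1 : ℚ[X])] {x y : K}
    (hx : x ^ 3 - 4 * x + 1 = 0) (hy : y ^ 2 = 229) :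
    (Subgroup.closure {u : (𝓞 K)ˣ |
        ((u : 𝓞 K) : K) = (15 + y) / 2 ∨
        ∃ σ : K ≃ₐ[ℚ] K, ((u : 𝓞 K) : K) = σ x ∨ ((u : 𝓞 K) : K) = σ x - 2}).FiniteIndex := by
  have : CharZero K := algebraRat.charZero K
  have hfin : FiniteDimensional ℚ K :=
    IsSplittingField.finiteDimensional K (X ^ 3 - 4 * X + 1 : ℚ[X])
  have : NumberField K := { to_finiteDimensional := by convert hfin; exact Subsingleton.elim _ _ }
  obtain ⟨b, c, h⟩ := exists_cubic_factorization hx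
  obtain ⟨hsix, hex⟩ := finrank_eq_six_and_exists_algEquiv h hy
  obtain ⟨σ, hσ, -⟩ := hex b c (by simp) (by simp) (roots_ne (c := x) fun t ↦ by rw [h t]; ring)
  have hb : b ^ 3 - 4 * b + 1 = 0 := by simp [h b]
  obtain ⟨E, hE⟩ := exists_unit_eq_of_sq hy
  obtain ⟨A, hA⟩ := exists_unit_eq_root hx
  obtain ⟨B, hB⟩ := exists_unit_eq_root hb
  obtain ⟨A₂, hA₂⟩ := exists_unit_eq_root_sub_two hx
  obtain ⟨B₂, hB₂⟩ := exists_unit_eq_root_sub_two hb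
  have φ : K →+* ℂ := Classical.arbitrary _
  have hindep : LinearIndependent ℤ fun i ↦ Additive.ofMul (![E, A, B, A₂, B₂] i) := by
    rw [Fintype.linearIndependent_iff]
    intro g hg
    have hg' : E ^ g 0 * A ^ g 1 * B ^ g 2 * A₂ ^ g 3 * B₂ ^ g 4 = 1 := by
      simpa [Fin.sum_univ_five] using congrArg Additive.toMul hg
    have hK : ((15 + y) / 2) ^ g 0 * x ^ g 1 * b ^ g 2 * (x - 2) ^ g 3 * (b - 2) ^ g 4 = 1 := by
      rw [← hE, ← hA₂, ← hB₂, ← hA, ← hB]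
      simpa [NumberField.Units.coe_zpow] using congrArg (fun u : (𝓞 K)ˣ ↦ ((u : 𝓞 K) : K)) hg'
    obtain ⟨h0, h1, h2, h3, h4⟩ := eq_zero_of_zpow_mul_eq_one h hy φ hK
    intro i
    fin_cases i <;> assumption
  have hrank : Module.finrank ℤ (Additive (𝓞 K)ˣ) ≤ Fintype.card (Fin 5) := by
    have hle := Units.rank_le_finrank_sub_one K
    have hfr : @Module.finrank ℚ K _ _ DivisionRing.toRatAlgebra.toModule = 6 := by
      rw [← hsix]
      congr 2
      exact Subsingleton.elim _ _
    rw [hfr] at hle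
    simpa [Units.finrank_eq] using hle
  have := finiteIndex_closure_range_of_linearIndependent _ hindep hrank
  refine Subgroup.finiteIndex_of_le (Subgroup.closure_mono ?_)
    (H := Subgroup.closure (Set.range ![E, A, B, A₂, B₂]))
  rintro _ ⟨i, rfl⟩
  fin_cases i
  · exact .inl hE
  · exact .inr ⟨1, .inl hA⟩
  · exact .inr ⟨σ, .inl (hB.trans hσ.symm)⟩
  · exact .inr ⟨1, .inr hA₂⟩
  · exact .inr ⟨σ, .inr (by rw [hσ]; exact hB₂)⟩

theorem units_generate_finite_index_subgroup
    (x : SplF) (hx : aeval x (X ^ 3 - 4 * X + 1 : ℚ[X]) = 0)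
    (y : SplF) (hy : y ^ 2 = 229) :
    (∃ u : (𝓞 SplF)ˣ, ((u : 𝓞 SplF) : SplF) = (15 + y) / 2) ∧
    (∀ σ : SplF ≃ₐ[ℚ] SplF, ∃ u : (𝓞 SplF)ˣ, ((u : 𝓞 SplF) : SplF) = σ x) ∧
    (∀ σ : SplF ≃ₐ[ℚ] SplF, ∃ u : (𝓞 SplF)ˣ, ((u : 𝓞 SplF) : SplF) = σ x - 2) ∧
    (Subgroup.closure {u : (𝓞 SplF)ˣ |
        ((u : 𝓞 SplF) : SplF) = (15 + y) / 2 ∨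
        ∃ σ : SplF ≃ₐ[ℚ] SplF,
          ((u : 𝓞 SplF) : SplF) = σ x ∨
          ((u : 𝓞 SplF) : SplF) = σ x - 2}).FiniteIndex := by
  have : IsSplittingField ℚ SplF (X ^ 3 - 4 * X + 1 : ℚ[X]) :=
    IsSplittingField.splittingField _
  have : CharZero SplF := algebraRat.charZero SplF
  have hx' : x ^ 3 - 4 * x + 1 = 0 := by simpa [map_ofNat] using hx
  have hσ (σ : SplF ≃ₐ[ℚ] SplF) : σ x ^ 3 - 4 * σ x + 1 = 0 := by
    simpa [map_ofNat] using congrArg σ hx'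
  exact ⟨exists_unit_eq_of_sq hy, fun σ ↦ exists_unit_eq_root (hσ σ),
    fun σ ↦ exists_unit_eq_root_sub_two (hσ σ),
    units_closure_finiteIndex_of_isSplittingField hx' hy⟩
end
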